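/- Let $u = (u_1, u_2, u_3)$ be a smooth compactly supported divergence-free vector field on $\mathbb{R}^3$, and let $\alpha > 2$ and $r = (3\alpha-2)/\alpha$. Then $\int_{\mathbb{R}^3} |u_3| \, |\nabla u| \, |\nabla_h \nabla u| \, dx \leq C \|u_3\|_{L^2}^{2(\alpha-1)/(3\alpha-2)} \|\partial_{x_3} u_3\|_{L^\alpha}^{\alpha/(3\alpha-2)} \|\nabla u\|_{L^2}^{(\alpha-2)/(3\alpha-2)} \|\partial_{x_1}\nabla u\|_{L^2}^{\alpha/(3\alpha-2)} \|\partial_{x_2}\nabla u\|_{L^2}^{\alpha/(3\alpha-2)} \|\nabla_h \nabla u\|_{L^2}$, with $C$ depending only on $\alpha$. -/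

import Mathlib

open MeasureTheory Real ENNReal

/-- Partial derivative in the `i`-th coordinate direction on `ℝ × ℝ × ℝ`. -/
noncomputable def pd (i : Fin 3) (φ : ℝ × ℝ × ℝ → ℝ) : ℝ × ℝ × ℝ → ℝ :=
  fun x => fderiv ℝ φ x (![((1:ℝ), (0:ℝ), (0:ℝ)), (0, 1, 0), (0, 0, 1)] i)

/-- Pointwise Euclidean norm of the full Jacobian of `u`. -/
noncomputable def gradNorm (u : Fin 3 → ℝ × ℝ × ℝ → ℝ) (x : ℝ × ℝ × ℝ) : ℝ :=
  Real.sqrt (∑ k : Fin 3, ∑ j : Fin 3, (pd j (u k) x) ^ 2)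

/-- Pointwise Euclidean norm of the horizontal second derivatives of `u`. -/
noncomputable def gradHGradNorm (u : Fin 3 → ℝ × ℝ × ℝ → ℝ) (x : ℝ × ℝ × ℝ) : ℝ :=
  Real.sqrt (∑ k : Fin 3, ∑ j : Fin 3, ∑ l : Fin 2, (pd l.castSucc (pd j (u k)) x) ^ 2)

/-- Pointwise norm of the derivative of the Jacobian in direction `i`. -/
noncomputable def dGradNorm (i : Fin 3) (u : Fin 3 → ℝ × ℝ × ℝ → ℝ) (x : ℝ × ℝ × ℝ) : ℝ :=
  Real.sqrt (∑ k : Fin 3, ∑ j : Fin 3, (pd i (pd j (u k)) x) ^ 2)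


lemma one_d {g : ℝ → ℝ} (hg : ContDiff ℝ 1 g) (hc : HasCompactSupport g) {p : ℝ} (hp : 1 < p)
    (x : ℝ) :
    ‖g x‖ₑ ^ p ≤ ENNReal.ofReal p * ∫⁻ t, ‖g t‖ₑ ^ (p - 1) * ‖deriv g t‖ₑ := by
  have h1 : ContDiff ℝ 1 (fun t => ‖g t‖ ^ p) := hg.norm_rpow hp
  have h2 : HasCompactSupport (fun t => ‖g t‖ ^ p) := by
    refine hc.comp_left (g := fun y : ℝ => ‖y‖ ^ p) ?_
    simp [Real.zero_rpow (by linarith : p ≠ 0)]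
  have h3 := h2.enorm_le_lintegral_Ici_deriv h1 x
  have e : ∀ y : ℝ, ∀ q : ℝ, 0 ≤ q → ‖(‖y‖ ^ q : ℝ)‖ₑ = ‖y‖ₑ ^ q := by
    intro y q hq
    rw [Real.enorm_rpow_of_nonneg (norm_nonneg _) hq, enorm_norm]
  rw [e _ _ (by linarith)] at h3
  refine h3.trans ((setLIntegral_le_lintegral _ _).trans ?_)
  rw [← lintegral_const_mul' _ _ ENNReal.ofReal_ne_top]
  refine lintegral_mono fun t => ?_
  have hd : HasDerivAt (fun t => ‖g t‖ ^ p) (p * ‖g t‖ ^ (p - 2) * g t * deriv g t) t :=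
    (hasDerivAt_norm_rpow (g t) hp).comp t ((hg.differentiable one_ne_zero) t).hasDerivAt
  rw [hd.deriv, ← mul_assoc, enorm_mul]
  gcongr
  have : ‖p * ‖g t‖ ^ (p - 2) * g t‖ = p * ‖g t‖ ^ (p - 1) := by
    rw [norm_mul, norm_mul, Real.norm_of_nonneg (by linarith : 0 ≤ p),
      Real.norm_of_nonneg (by positivity : 0 ≤ ‖g t‖ ^ (p - 2)), mul_assoc]
    congr 1
    by_cases h0 : ‖g t‖ = 0
    · rw [h0, Real.zero_rpow (by linarith : p - 1 ≠ 0), mul_zero]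
    · rw [show p - 1 = (p - 2) + 1 by ring, Real.rpow_add_one h0]
  rw [← ofReal_norm, this, ENNReal.ofReal_mul (by linarith), ← e _ _ (by linarith), 
    Real.enorm_of_nonneg (by positivity)]

lemma slice_sq {k : ℝ × ℝ → ℝ} (hk : ContDiff ℝ 1 k) (hc : HasCompactSupport k) :
    ∃ K : ℝ → ℝ, ContDiff ℝ 1 K ∧ HasCompactSupport K ∧
      (∀ t, ‖K t‖ₑ = ∫⁻ z, ‖k (t, z)‖ₑ ^ (2:ℝ)) ∧
      (∀ t, ‖deriv K t‖ₑ ≤ ∫⁻ z, 2 * (‖k (t, z)‖ₑ * ‖fderiv ℝ k (t, z) (1, 0)‖ₑ)) := by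
  obtain ⟨R, hR⟩ := hc.isCompact.isBounded.subset_closedBall 0
  have hz : ∀ t z, (R < |t| ∨ R < |z|) → k (t, z) = 0 := by
    intro t z h
    by_contra hne
    have := hR (subset_tsupport _ (Function.mem_support.2 hne))
    rw [mem_closedBall_zero_iff, Prod.norm_def, max_le_iff] at this
    simp only [Real.norm_eq_abs] at this
    rcases h with h | h <;> linarith [this.1, this.2]
  set S : Set ℝ := Set.Icc (-R) R with hS
  have hSc : IsCompact S := isCompact_Icc
  have hzS : ∀ t, ∀ z, z ∉ S → k (t, z) = 0 := by
    intro t z h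
    apply hz; right
    rw [hS, Set.mem_Icc, ← abs_le] at h
    exact not_le.1 h
  have hd : Continuous fun x => fderiv ℝ k x (1, 0) :=
    (hk.continuous_fderiv one_ne_zero).clm_apply continuous_const
  have hk0 := hk.continuous
  let F' : ℝ → ℝ → ℝ := fun t z => 2 * (k (t, z) * fderiv ℝ k (t, z) (1, 0))
  have hF'c : Continuous (Function.uncurry F') := by
    simp only [F', Function.uncurry_def]
    exact continuous_const.mul (hk0.mul hd)
  have hF'supp : HasCompactSupport (Function.uncurry F') := by
    have : HasCompactSupport (fun x => k x * (2 * fderiv ℝ k x (1, 0))) := hc.mul_right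
    convert this using 1
    ext ⟨a, b⟩; simp only [F', Function.uncurry]; ring
  obtain ⟨B, hB⟩ := hF'supp.exists_bound_of_continuous hF'c
  have hder : ∀ t, HasDerivAt (fun t => ∫ z in S, k (t, z) ^ 2) (∫ z in S, F' t z) t := by
    intro t
    refine (hasDerivAt_integral_of_dominated_loc_of_deriv_le (s := Set.univ) (bound := fun _ => B)
      (F := fun t z => k (t, z) ^ 2) Filter.univ_mem ?_ ?_ ?_ ?_ ?_ ?_).2
    · refine Filter.Eventually.of_forall fun x => ?_
      exact (by fun_prop : Continuous fun z => k (x, z) ^ 2).aestronglyMeasurable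
    · exact (by fun_prop : Continuous fun z => k (t, z) ^ 2).continuousOn.integrableOn_compact hSc
    · exact (hF'c.comp (by fun_prop : Continuous fun z : ℝ => (t, z))).aestronglyMeasurable
    · exact Filter.Eventually.of_forall fun z x _ => hB (x, z)
    · exact (continuous_const.continuousOn.integrableOn_compact hSc)
    · refine Filter.Eventually.of_forall fun z x _ => ?_
      have h1 : HasDerivAt (fun t : ℝ => (t, z)) ((1:ℝ), (0:ℝ)) x :=
        (hasDerivAt_id x).prodMk (hasDerivAt_const x z)
      have h2 := ((hk.differentiable one_ne_zero (x, z)).hasFDerivAt.comp_hasDerivAt x h1).pow 2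
      refine h2.congr_deriv ?_
      simp only [F', Function.comp]; push_cast; ring
  refine ⟨fun t => ∫ z in S, k (t, z) ^ 2, ?_, ?_, ?_, ?_⟩
  · rw [contDiff_one_iff_deriv]
    refine ⟨fun t => (hder t).differentiableAt, ?_⟩
    rw [show deriv (fun t => ∫ z in S, k (t, z) ^ 2) = fun t => ∫ z in S, F' t z from
      funext fun t => (hder t).deriv]
    exact continuous_parametric_integral_of_continuous hF'c hSc
  · refine HasCompactSupport.intro (K := Set.Icc (-R) R) isCompact_Icc fun t ht => ?_
    have : ∀ z, k (t, z) = 0 := fun z => hz t z (Or.inl (by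
      rw [Set.mem_Icc, ← abs_le] at ht; exact not_le.1 ht))
    simp [this]
  · intro t
    beta_reduce
    rw [setIntegral_eq_integral_of_forall_compl_eq_zero (fun z hz' => by
      rw [hzS t z hz']; simp)]
    have hi : Integrable (fun z => k (t, z) ^ 2) := by
      refine Continuous.integrable_of_hasCompactSupport (by fun_prop) ?_
      exact HasCompactSupport.intro hSc fun z hz' => by simp [hzS t z hz']
    rw [Real.enorm_of_nonneg (integral_nonneg fun z => sq_nonneg _),
      ofReal_integral_eq_lintegral_ofReal hi (Filter.Eventually.of_forall fun z => sq_nonneg _)]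
    refine lintegral_congr fun z => ?_
    rw [← Real.enorm_of_nonneg (sq_nonneg _), enorm_pow]
    norm_cast
  · intro t
    rw [(hder t).deriv]
    refine (enorm_integral_le_lintegral_enorm _).trans ((setLIntegral_le_lintegral _ _).trans ?_)
    refine lintegral_mono fun z => ?_
    simp only [F', enorm_mul]
    gcongr
    simp [enorm_eq_nnnorm]

lemma cs {X : Type*} [MeasurableSpace X] {μ : Measure X} {f g : X → ℝ≥0∞} (hf : Measurable f)
    (hg : Measurable g) :
    ∫⁻ x, f x * g x ∂μ ≤ (∫⁻ x, f x ^ (2:ℝ) ∂μ) ^ (1/2 : ℝ) * (∫⁻ x, g x ^ (2:ℝ) ∂μ) ^ (1/2 : ℝ) :=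
  ENNReal.lintegral_mul_le_Lp_mul_Lq μ Real.HolderConjugate.two_two hf.aemeasurable hg.aemeasurable

/-- one-dimensional bound for vertical masses -/
lemma slice_bound {k : ℝ × ℝ → ℝ} (hk : ContDiff ℝ 1 k) (hc : HasCompactSupport k) {s : ℝ}
    (hs : 2 < s) (t : ℝ) :
    (∫⁻ z, ‖k (t, z)‖ₑ ^ (2:ℝ)) ^ (s / 2) ≤
      ENNReal.ofReal s * ∫⁻ t, (∫⁻ z, ‖k (t, z)‖ₑ ^ (2:ℝ)) ^ ((s - 1) / 2) *
        (∫⁻ z, ‖fderiv ℝ k (t, z) (1, 0)‖ₑ ^ (2:ℝ)) ^ (1/2 : ℝ) := by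
  obtain ⟨K, h1, h2, h3, h4⟩ := slice_sq hk hc
  have hd : Continuous fun x => fderiv ℝ k x (1, 0) :=
    (hk.continuous_fderiv one_ne_zero).clm_apply continuous_const
  have hk0 := hk.continuous
  have h := one_d h1 h2 (p := s / 2) (by linarith) t
  rw [h3] at h
  refine h.trans ?_
  have e : ENNReal.ofReal s = ENNReal.ofReal (s / 2) * 2 := by
    rw [show (2:ℝ≥0∞) = ENNReal.ofReal 2 by simp, ← ENNReal.ofReal_mul (by linarith)]
    congr 1; ring
  rw [e, mul_assoc, ← lintegral_const_mul' 2 _ (by simp)]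
  refine mul_le_mul_right (lintegral_mono fun t => ?_) _
  rw [h3]
  have h5 : ‖deriv K t‖ₑ ≤ 2 * ((∫⁻ z, ‖k (t, z)‖ₑ ^ (2:ℝ)) ^ (1/2 : ℝ) *
        (∫⁻ z, ‖fderiv ℝ k (t, z) (1, 0)‖ₑ ^ (2:ℝ)) ^ (1/2 : ℝ)) := by
    refine (h4 t).trans ?_
    rw [lintegral_const_mul' _ _ (by simp)]
    gcongr
    refine cs ?_ ?_
    · exact (by fun_prop : Continuous fun z => k (t, z)).enorm.measurable
    · exact (hd.comp (by fun_prop : Continuous fun z : ℝ => (t, z))).enorm.measurable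
  refine (mul_le_mul_right h5 _).trans (le_of_eq ?_)
  rw [show (s - 1) / 2 = (s / 2 - 1) + 1 / 2 by ring,
    ENNReal.rpow_add_of_nonneg _ _ (by linarith) (by norm_num)]
  ring

lemma fub {H : ℝ × ℝ × ℝ → ℝ≥0∞} (hH : Measurable H) :
    ∫⁻ x, H x = ∫⁻ p : ℝ × ℝ, ∫⁻ z, H (p.1, p.2, z) := by
  rw [Measure.volume_eq_prod, lintegral_prod _ hH.aemeasurable, Measure.volume_eq_prod,
    lintegral_prod _ (Measurable.aemeasurable ?_)]
  · refine lintegral_congr fun x => ?_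
    rw [lintegral_prod _ (Measurable.aemeasurable (by fun_prop))]
  · refine Measurable.lintegral_prod_right' (f := fun q : (ℝ × ℝ) × ℝ => H (q.1.1, q.1.2, q.2)) ?_
    fun_prop

lemma meas_slice {H : ℝ × ℝ × ℝ → ℝ≥0∞} (hH : Measurable H) :
    Measurable fun p : ℝ × ℝ => ∫⁻ z, H (p.1, p.2, z) := by
  refine Measurable.lintegral_prod_right' (f := fun q : (ℝ × ℝ) × ℝ => H (q.1.1, q.1.2, q.2)) ?_
  fun_prop

/-- vertical square mass -/
noncomputable def vm (f : ℝ × ℝ × ℝ → ℝ) (p : ℝ × ℝ) : ℝ≥0∞ :=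
  ∫⁻ z, ‖f (p.1, p.2, z)‖ₑ ^ (2:ℝ)

lemma vm_meas {f : ℝ × ℝ × ℝ → ℝ} (hf : Measurable f) : Measurable (vm f) :=
  meas_slice (H := fun x => ‖f x‖ₑ ^ (2:ℝ)) (by fun_prop)

lemma vm_int {f : ℝ × ℝ × ℝ → ℝ} (hf : Measurable f) :
    ∫⁻ p, vm f p = ∫⁻ x, ‖f x‖ₑ ^ (2:ℝ) :=
  (fub (H := fun x => ‖f x‖ₑ ^ (2:ℝ)) (by fun_prop)).symm

lemma pd_cont {f : ℝ × ℝ × ℝ → ℝ} (hf : ContDiff ℝ 1 f) (i : Fin 3) : Continuous (pd i f) :=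
  (hf.continuous_fderiv one_ne_zero).clm_apply continuous_const

lemma pl0 {f : ℝ × ℝ × ℝ → ℝ} (hf : ContDiff ℝ 1 f) (hc : HasCompactSupport f) {s : ℝ}
    (hs : 2 < s) (x y : ℝ) :
    vm f (x, y) ^ (s / 2) ≤ ENNReal.ofReal s * ∫⁻ t, vm f (t, y) ^ ((s - 1) / 2) *
        vm (pd 0 f) (t, y) ^ (1/2 : ℝ) := by
  have hk : ContDiff ℝ 1 (fun q : ℝ × ℝ => f (q.1, y, q.2)) := by fun_prop
  have hcl : Topology.IsClosedEmbedding (fun q : ℝ × ℝ => (q.1, y, q.2)) := by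
    refine Topology.IsClosedEmbedding.of_continuous_injective_isClosedMap (by fun_prop) ?_ ?_
    · rintro ⟨a, b⟩ ⟨c, d⟩ h
      simpa using h
    · have : Isometry (fun q : ℝ × ℝ => (q.1, y, q.2)) := by
        refine Isometry.of_dist_eq fun p q => ?_
        simp [Prod.dist_eq]
      exact this.isClosedEmbedding.isClosedMap
  have h := slice_bound hk (hc.comp_isClosedEmbedding hcl) hs x
  have hd : ∀ t z, fderiv ℝ (fun q : ℝ × ℝ => f (q.1, y, q.2)) (t, z) (1, 0) = pd 0 f (t, y, z) := by
    intro t z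
    have h1 : HasFDerivAt (fun q : ℝ × ℝ => (q.1, y, q.2))
      ((ContinuousLinearMap.fst ℝ ℝ ℝ).prod ((0 : ℝ × ℝ →L[ℝ] ℝ).prod
        (ContinuousLinearMap.snd ℝ ℝ ℝ))) (t, z) :=
      hasFDerivAt_fst.prodMk ((hasFDerivAt_const _ _).prodMk hasFDerivAt_snd)
    have h2 := (hf.differentiable one_ne_zero (t, y, z)).hasFDerivAt.comp (t, z) h1
    have h3 := h2.fderiv
    simp only [Function.comp_def] at h3
    rw [h3]
    simp [pd]
  simp only [hd] at h
  exact h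

lemma pl1 {f : ℝ × ℝ × ℝ → ℝ} (hf : ContDiff ℝ 1 f) (hc : HasCompactSupport f) {s : ℝ}
    (hs : 2 < s) (x y : ℝ) :
    vm f (x, y) ^ (s / 2) ≤ ENNReal.ofReal s * ∫⁻ t, vm f (x, t) ^ ((s - 1) / 2) *
        vm (pd 1 f) (x, t) ^ (1/2 : ℝ) := by
  have hk : ContDiff ℝ 1 (fun q : ℝ × ℝ => f (x, q.1, q.2)) := by fun_prop
  have hcl : Topology.IsClosedEmbedding (fun q : ℝ × ℝ => (x, q.1, q.2)) := by
    have : Isometry (fun q : ℝ × ℝ => (x, q.1, q.2)) := by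
      refine Isometry.of_dist_eq fun p q => ?_
      simp [Prod.dist_eq]
    exact this.isClosedEmbedding
  have h := slice_bound hk (hc.comp_isClosedEmbedding hcl) hs y
  have hd : ∀ t z, fderiv ℝ (fun q : ℝ × ℝ => f (x, q.1, q.2)) (t, z) (1, 0) = pd 1 f (x, t, z) := by
    intro t z
    have h1 : HasFDerivAt (fun q : ℝ × ℝ => (x, q.1, q.2))
      ((0 : ℝ × ℝ →L[ℝ] ℝ).prod ((ContinuousLinearMap.fst ℝ ℝ ℝ).prod
        (ContinuousLinearMap.snd ℝ ℝ ℝ))) (t, z) :=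
      (hasFDerivAt_const _ _).prodMk (hasFDerivAt_fst.prodMk hasFDerivAt_snd)
    have h2 := (hf.differentiable one_ne_zero (x, t, z)).hasFDerivAt.comp (t, z) h1
    have h3 := h2.fderiv
    simp only [Function.comp_def] at h3
    rw [h3]
    simp [pd]
  simp only [hd] at h
  exact h

lemma pl2 {f : ℝ × ℝ × ℝ → ℝ} (hf : ContDiff ℝ 1 f) (hc : HasCompactSupport f) {r : ℝ}
    (hr : 1 < r) (p : ℝ × ℝ) (z : ℝ) :
    ‖f (p.1, p.2, z)‖ₑ ^ r ≤ ENNReal.ofReal r * ∫⁻ t, ‖f (p.1, p.2, t)‖ₑ ^ (r - 1) *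
        ‖pd 2 f (p.1, p.2, t)‖ₑ := by
  have hk : ContDiff ℝ 1 (fun q : ℝ => f (p.1, p.2, q)) := by fun_prop
  have hcl : Topology.IsClosedEmbedding (fun q : ℝ => (p.1, p.2, q)) := by
    have : Isometry (fun q : ℝ => (p.1, p.2, q)) := by
      refine Isometry.of_dist_eq fun p q => ?_
      simp [Prod.dist_eq]
    exact this.isClosedEmbedding
  have h := one_d hk (hc.comp_isClosedEmbedding hcl) hr z
  have hd : ∀ z, deriv (fun q : ℝ => f (p.1, p.2, q)) z = pd 2 f (p.1, p.2, z) := by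
    intro z
    have h1 : HasDerivAt (fun q : ℝ => (p.1, p.2, q)) ((0:ℝ), (0:ℝ), (1:ℝ)) z :=
      (hasDerivAt_const _ _).prodMk ((hasDerivAt_const _ _).prodMk (hasDerivAt_id _))
    exact ((hf.differentiable one_ne_zero
      (p.1, p.2, z)).hasFDerivAt.comp_hasDerivAt z h1).deriv
  simp only [hd] at h
  exact h

lemma planar {f : ℝ × ℝ × ℝ → ℝ} (hf : ContDiff ℝ 1 f) (hc : HasCompactSupport f) {s : ℝ}
    (hs : 2 < s) :
    ∫⁻ p, vm f p ^ s ≤ ENNReal.ofReal s ^ (2:ℕ) * (∫⁻ p, vm f p ^ (s - 1)) *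
      ((∫⁻ x, ‖pd 0 f x‖ₑ ^ (2:ℝ)) ^ (1/2 : ℝ) * (∫⁻ x, ‖pd 1 f x‖ₑ ^ (2:ℝ)) ^ (1/2 : ℝ)) := by
  have m := vm_meas hf.continuous.measurable
  have m0 := vm_meas (pd_cont hf 0).measurable
  have m1 := vm_meas (pd_cont hf 1).measurable
  have key : ∀ g : ℝ × ℝ × ℝ → ℝ, Measurable g →
      ∫⁻ p, vm f p ^ ((s - 1) / 2) * vm g p ^ (1/2 : ℝ) ≤
      (∫⁻ p, vm f p ^ (s - 1)) ^ (1/2 : ℝ) * (∫⁻ x, ‖g x‖ₑ ^ (2:ℝ)) ^ (1/2 : ℝ) := by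
    intro g hg
    have mg := vm_meas hg
    refine (cs (by fun_prop) (by fun_prop)).trans (le_of_eq ?_)
    rw [← vm_int hg]
    simp only [← ENNReal.rpow_mul]
    norm_num
  calc ∫⁻ p, vm f p ^ s ≤ ∫⁻ p : ℝ × ℝ,
        (ENNReal.ofReal s * ∫⁻ t, vm f (p.1, t) ^ ((s - 1) / 2) * vm (pd 1 f) (p.1, t) ^ (1/2 : ℝ)) *
        (ENNReal.ofReal s * ∫⁻ t, vm f (t, p.2) ^ ((s - 1) / 2) * vm (pd 0 f) (t, p.2) ^ (1/2 : ℝ)) := by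
        refine lintegral_mono fun p => ?_
        rw [show s = s / 2 + s / 2 by ring, ENNReal.rpow_add_of_nonneg _ _ (by linarith) (by linarith),
          ← show s = s / 2 + s / 2 by ring]
        exact mul_le_mul' (pl1 hf hc hs p.1 p.2) (pl0 hf hc hs p.1 p.2)
    _ = (ENNReal.ofReal s * ∫⁻ p, vm f p ^ ((s - 1) / 2) * vm (pd 1 f) p ^ (1/2 : ℝ)) *
        (ENNReal.ofReal s * ∫⁻ p, vm f p ^ ((s - 1) / 2) * vm (pd 0 f) p ^ (1/2 : ℝ)) := by
        rw [Measure.volume_eq_prod, lintegral_prod_mul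
          (f := fun x => ENNReal.ofReal s * ∫⁻ t, vm f (x, t) ^ ((s - 1) / 2) * vm (pd 1 f) (x, t) ^ (1/2 : ℝ))
          (g := fun y => ENNReal.ofReal s * ∫⁻ t, vm f (t, y) ^ ((s - 1) / 2) * vm (pd 0 f) (t, y) ^ (1/2 : ℝ)),
          lintegral_const_mul' _ _ (by simp), lintegral_const_mul' _ _ (by simp),
          lintegral_prod _ (Measurable.aemeasurable (by fun_prop)),
          lintegral_prod_symm _ (Measurable.aemeasurable (by fun_prop))]
        · refine (Measurable.const_mul ?_ _).aemeasurable
          exact Measurable.lintegral_prod_right' (f := fun p =>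
            vm f p ^ ((s - 1) / 2) * vm (pd 1 f) p ^ (1/2 : ℝ)) (by fun_prop)
        · refine (Measurable.const_mul ?_ _).aemeasurable
          exact Measurable.lintegral_prod_left' (f := fun p =>
            vm f p ^ ((s - 1) / 2) * vm (pd 0 f) p ^ (1/2 : ℝ)) (by fun_prop)
    _ ≤ _ := by
        refine (mul_le_mul' (mul_le_mul_right (key _ (pd_cont hf 1).measurable) _)
          (mul_le_mul_right (key _ (pd_cont hf 0).measurable) _)).trans (le_of_eq ?_)
        set T := ∫⁻ p, vm f p ^ (s - 1)
        have : T = T ^ (1/2 : ℝ) * T ^ (1/2 : ℝ) := by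
          rw [← ENNReal.rpow_add_of_nonneg _ _ (by norm_num) (by norm_num)]; norm_num
        conv_rhs => rw [this]
        ring

lemma vm_fin {f : ℝ × ℝ × ℝ → ℝ} (hf : Continuous f) (hc : HasCompactSupport f) {s : ℝ}
    (hs : 0 < s) : ∫⁻ p, vm f p ^ s ≠ ⊤ := by
  obtain ⟨R, hR⟩ := hc.isCompact.isBounded.subset_closedBall 0
  obtain ⟨B, hB⟩ := hc.exists_bound_of_continuous hf
  have hz : ∀ p : ℝ × ℝ, ∀ z, (p ∉ Metric.closedBall 0 R ∨ z ∉ Metric.closedBall (0:ℝ) R) →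
      f (p.1, p.2, z) = 0 := by
    intro p z h
    by_contra hne
    have := hR (subset_tsupport _ (Function.mem_support.2 hne))
    simp only [mem_closedBall_zero_iff, Prod.norm_def, max_le_iff] at this h
    tauto
  set c : ℝ≥0∞ := ENNReal.ofReal B ^ (2:ℝ) * volume (Metric.closedBall (0:ℝ) R) with hcdef
  have hcfin : c ≠ ⊤ := ENNReal.mul_ne_top (by simp) measure_closedBall_lt_top.ne
  have hvm : ∀ p, vm f p ≤ c := by
    intro p
    calc vm f p ≤ ∫⁻ z, (Metric.closedBall (0:ℝ) R).indicator (fun _ => ENNReal.ofReal B ^ (2:ℝ)) z := by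
          refine lintegral_mono fun z => ?_
          by_cases h : z ∈ Metric.closedBall (0:ℝ) R
          · rw [Set.indicator_of_mem h]
            gcongr
            rw [← ofReal_norm]
            exact ENNReal.ofReal_le_ofReal (hB _)
          · rw [hz p z (Or.inr h)]; simp
      _ = c := by
          rw [lintegral_indicator Metric.isClosed_closedBall.measurableSet]
          simp [hcdef]
  have h2 : ∫⁻ p, vm f p ^ s ≤ ∫⁻ p, (Metric.closedBall (0:ℝ×ℝ) R).indicator (fun _ => c ^ s) p := by
    refine lintegral_mono fun p => ?_
    by_cases h : p ∈ Metric.closedBall (0:ℝ×ℝ) R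
    · rw [Set.indicator_of_mem h]
      exact ENNReal.rpow_le_rpow (hvm p) hs.le
    · have : vm f p = 0 := by simp [vm, hz p _ (Or.inl h)]
      simp [this, hs]
  refine ne_top_of_le_ne_top ?_ h2
  rw [lintegral_indicator Metric.isClosed_closedBall.measurableSet, setLIntegral_const]
  exact ENNReal.mul_ne_top (ENNReal.rpow_ne_top_of_nonneg hs.le hcfin) measure_closedBall_lt_top.ne

lemma planar' {f : ℝ × ℝ × ℝ → ℝ} (hf : ContDiff ℝ 1 f) (hc : HasCompactSupport f) {s : ℝ}
    (hs : 2 < s) :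
    ∫⁻ p, vm f p ^ s ≤ (∫⁻ x, ‖f x‖ₑ ^ (2:ℝ)) * (ENNReal.ofReal s ^ (2:ℕ) * 
      ((∫⁻ x, ‖pd 0 f x‖ₑ ^ (2:ℝ)) ^ (1/2 : ℝ) * (∫⁻ x, ‖pd 1 f x‖ₑ ^ (2:ℝ)) ^ (1/2 : ℝ))) ^ (s - 1) := by
  have h := planar hf hc hs
  have m := vm_meas hf.continuous.measurable
  have fin := vm_fin hf.continuous hc (by linarith : 0 < s)
  have hs1 : s - 1 ≠ 0 := by linarith
  have hT : ∫⁻ p, vm f p ^ (s - 1) ≤ (∫⁻ p, vm f p) ^ (1 / (s - 1)) *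
      (∫⁻ p, vm f p ^ s) ^ (1 - 1 / (s - 1)) := by
    have h1 : 1 / (s - 1) ≤ 1 := by rw [div_le_one (by linarith)]; linarith
    have h0 : 0 ≤ 1 / (s - 1) := by apply div_nonneg <;> linarith
    refine le_trans (le_of_eq ?_) (ENNReal.lintegral_mul_norm_pow_le (f := vm f)
      (g := fun p => vm f p ^ s) m.aemeasurable (by fun_prop) h0 (by linarith) (by ring))
    refine lintegral_congr fun p => ?_
    rw [← ENNReal.rpow_mul, ← ENNReal.rpow_add_of_nonneg _ _ h0
      (mul_nonneg (by linarith) (by linarith))]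
    congr 1
    field_simp
    ring
  rw [vm_int hf.continuous.measurable] at hT
  generalize (∫⁻ p, vm f p ^ s) = S at *
  generalize (∫⁻ p, vm f p ^ (s - 1)) = T at *
  generalize (∫⁻ x, ‖f x‖ₑ ^ (2:ℝ)) = A at *
  generalize ((∫⁻ x, ‖pd 0 f x‖ₑ ^ (2:ℝ)) ^ (1/2 : ℝ) * (∫⁻ x, ‖pd 1 f x‖ₑ ^ (2:ℝ)) ^ (1/2 : ℝ)) = D at *
  generalize ENNReal.ofReal s ^ (2:ℕ) = c at *
  by_cases hS : S = 0
  · rw [hS]; exact zero_le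
  have hpos : 0 < 1 / (s - 1) := by apply div_pos <;> linarith
  have h3 : S ^ (1 / (s - 1)) ≤ A ^ (1 / (s - 1)) * (c * D) := by
    have h4 : S ^ (1 / (s - 1)) * S ^ (1 - 1 / (s - 1)) ≤
        (A ^ (1 / (s - 1)) * (c * D)) * S ^ (1 - 1 / (s - 1)) := by
      rw [← ENNReal.rpow_add _ _ hS fin]
      have : S ^ (1 / (s - 1) + (1 - 1 / (s - 1))) = S := by simp
      rw [this]
      refine h.trans ?_
      calc c * T * D ≤ c * (A ^ (1 / (s - 1)) * S ^ (1 - 1 / (s - 1))) * D := by gcongr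
        _ = _ := by ring
    refine (ENNReal.mul_le_mul_iff_left ?_ ?_).1 h4
    · simp [ENNReal.rpow_eq_zero_iff, hS, fin]
    · simp [ENNReal.rpow_eq_top_iff, hS, fin]
  have h5 := ENNReal.rpow_le_rpow h3 (by linarith : 0 ≤ s - 1)
  rwa [ENNReal.mul_rpow_of_nonneg _ _ (by linarith : 0 ≤ s - 1), ← ENNReal.rpow_mul,
    ← ENNReal.rpow_mul, one_div_mul_cancel hs1, ENNReal.rpow_one, ENNReal.rpow_one] at h5

lemma e2 (f : ℝ × ℝ × ℝ → ℝ) : eLpNorm f 2 volume = (∫⁻ x, ‖f x‖ₑ ^ (2:ℝ)) ^ (1/2 : ℝ) := by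
  rw [eLpNorm_eq_lintegral_rpow_enorm_toReal (by simp) (by simp)]; simp

/-- The anisotropic trilinear estimate (Lemma 2.2). -/
lemma tri {α r s : ℝ} (hα : 2 < α) (hr : r = (3 * α - 2) / α) (hs : s = r / (r - 2))
    {φ f g : ℝ × ℝ × ℝ → ℝ} (hφ : ContDiff ℝ 1 φ) (hφc : HasCompactSupport φ)
    (hf : ContDiff ℝ 1 f) (hfc : HasCompactSupport f) (hg : Measurable g) :
    ∫⁻ x, ‖φ x‖ₑ * ‖f x‖ₑ * ‖g x‖ₑ ≤
      (ENNReal.ofReal r ^ (1 / r) * (ENNReal.ofReal s ^ (2:ℕ)) ^ (1 / r))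
       * eLpNorm φ 2 volume ^ (2 * (α - 1) / (3 * α - 2))
          * eLpNorm (pd 2 φ) (ENNReal.ofReal α) volume ^ (α / (3 * α - 2))
          * eLpNorm f 2 volume ^ ((α - 2) / (3 * α - 2))
          * eLpNorm (pd 0 f) 2 volume ^ (α / (3 * α - 2))
          * eLpNorm (pd 1 f) 2 volume ^ (α / (3 * α - 2))
          * eLpNorm g 2 volume := by
  have hα0 : 0 < α := by linarith
  have hd0 : 0 < 3 * α - 2 := by linarith
  have hr2 : 2 < r := by rw [hr, lt_div_iff₀ hα0]; linarith
  have hr3 : r < 3 := by rw [hr, div_lt_iff₀ hα0]; linarith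
  have hs2 : 2 < s := by rw [hs, lt_div_iff₀ (by linarith)]; linarith
  have hs0 : s ≠ 0 := by linarith
  have hr0 : r ≠ 0 := by linarith
  have hr20 : r - 2 ≠ 0 := by linarith
  have hir : 1 / r = α / (3 * α - 2) := by rw [hr, one_div_div]
  have his : 1 / (2 * s) = (r - 2) / (2 * r) := by rw [hs]; field_simp
  have mφ := hφ.continuous.measurable
  have mf := hf.continuous.measurable
  have mφ2 := (pd_cont hφ 2).measurable
  have mvf := vm_meas mf
  have mvg := vm_meas hg
  set M : ℝ × ℝ → ℝ≥0∞ := fun p => ENNReal.ofReal r * ∫⁻ t, ‖φ (p.1, p.2, t)‖ₑ ^ (r - 1) *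
        ‖pd 2 φ (p.1, p.2, t)‖ₑ with hM
  have mM : Measurable M := Measurable.const_mul
    (meas_slice (H := fun x => ‖φ x‖ₑ ^ (r - 1) * ‖pd 2 φ x‖ₑ) (by fun_prop)) _
  have step1 : ∫⁻ x, ‖φ x‖ₑ * ‖f x‖ₑ * ‖g x‖ₑ ≤
      ∫⁻ p, M p ^ (1 / r) * (vm f p ^ s) ^ (1 / (2 * s)) * vm g p ^ (1/2 : ℝ) := by
    rw [fub (H := fun x => ‖φ x‖ₑ * ‖f x‖ₑ * ‖g x‖ₑ) (by fun_prop)]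
    refine lintegral_mono fun p => ?_
    have hφM : ∀ z, ‖φ (p.1, p.2, z)‖ₑ ≤ M p ^ (1 / r) := by
      intro z
      have := ENNReal.rpow_le_rpow (pl2 hφ hφc (by linarith : 1 < r) p z)
        (by positivity : 0 ≤ 1 / r)
      rwa [← ENNReal.rpow_mul, mul_one_div_cancel hr0, ENNReal.rpow_one] at this
    calc ∫⁻ z, ‖φ (p.1, p.2, z)‖ₑ * ‖f (p.1, p.2, z)‖ₑ * ‖g (p.1, p.2, z)‖ₑ
        ≤ ∫⁻ z, M p ^ (1 / r) * (‖f (p.1, p.2, z)‖ₑ * ‖g (p.1, p.2, z)‖ₑ) := by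
          refine lintegral_mono fun z => ?_
          rw [mul_assoc]
          exact mul_le_mul_left (hφM z) _
      _ = M p ^ (1 / r) * ∫⁻ z, (‖f (p.1, p.2, z)‖ₑ * ‖g (p.1, p.2, z)‖ₑ) :=
          lintegral_const_mul _ (by fun_prop)
      _ ≤ M p ^ (1 / r) * (vm f p ^ (1/2 : ℝ) * vm g p ^ (1/2 : ℝ)) :=
          mul_le_mul_right (cs (by fun_prop) (by fun_prop)) _
      _ = _ := by
          rw [← ENNReal.rpow_mul, mul_assoc]
          congr 3
          field_simp
  have step2 : ∫⁻ p, M p ^ (1 / r) * (vm f p ^ s) ^ (1 / (2 * s)) * vm g p ^ (1/2 : ℝ) ≤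
      (∫⁻ p, M p) ^ (1 / r) * (∫⁻ p, vm f p ^ s) ^ (1 / (2 * s)) * (∫⁻ p, vm g p) ^ (1/2 : ℝ) := by
    have := ENNReal.lintegral_prod_norm_pow_le (μ := (volume : Measure (ℝ × ℝ)))
      (Finset.univ : Finset (Fin 3)) (f := ![M, fun p => vm f p ^ s, vm g])
      (p := ![1 / r, 1 / (2 * s), 1 / 2]) ?_ ?_ ?_
    · simpa [Fin.prod_univ_three] using this
    · intro i _
      fin_cases i
      · exact mM.aemeasurable
      · exact (mvf.pow_const s).aemeasurable
      · exact mvg.aemeasurable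
    · simp only [Fin.sum_univ_three, Matrix.cons_val]
      rw [his]; field_simp; ring
    · intro i _
      fin_cases i <;> simp <;> linarith
  have stepM : ∫⁻ p, M p ≤ ENNReal.ofReal r * ((∫⁻ x, ‖φ x‖ₑ ^ (2:ℝ)) ^ ((r - 1) / 2) *
      (∫⁻ x, ‖pd 2 φ x‖ₑ ^ α) ^ (1 / α)) := by
    simp only [hM]
    rw [lintegral_const_mul' _ _ (by simp),
      ← fub (H := fun x => ‖φ x‖ₑ ^ (r - 1) * ‖pd 2 φ x‖ₑ) (by fun_prop)]
    refine mul_le_mul_right ?_ _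
    refine le_trans (le_of_eq ?_) (ENNReal.lintegral_mul_norm_pow_le
      (f := fun x => ‖φ x‖ₑ ^ (2:ℝ)) (g := fun x => ‖pd 2 φ x‖ₑ ^ α)
      (by fun_prop) (by fun_prop) (by linarith) (by positivity) ?_)
    · refine lintegral_congr fun x => ?_
      rw [← ENNReal.rpow_mul, ← ENNReal.rpow_mul, mul_one_div_cancel hα0.ne', ENNReal.rpow_one]
      congr 2; ring
    · rw [hr]; field_simp; ring
  refine step1.trans (step2.trans ?_)
  have h1 := ENNReal.rpow_le_rpow stepM (by positivity : 0 ≤ 1 / r)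
  have h2 := ENNReal.rpow_le_rpow (planar' hf hfc hs2) (by positivity : 0 ≤ 1 / (2 * s))
  rw [vm_int hg, ← e2 g]
  refine (mul_le_mul_left (mul_le_mul' h1 h2) _).trans (le_of_eq ?_)
  have eα : eLpNorm (pd 2 φ) (ENNReal.ofReal α) volume = (∫⁻ x, ‖pd 2 φ x‖ₑ ^ α) ^ (1 / α) := by
    rw [eLpNorm_eq_lintegral_rpow_enorm_toReal (by simp [hα0]) (by simp), ENNReal.toReal_ofReal hα0.le]
  have a1 : (∫⁻ x, ‖φ x‖ₑ ^ (2:ℝ)) ^ ((r - 1) / 2 * (1 / r)) =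
      eLpNorm φ 2 volume ^ (2 * (α - 1) / (3 * α - 2)) := by
    rw [e2, ← ENNReal.rpow_mul]
    congr 1; rw [hir, hr]; field_simp; ring
  have a2 : (∫⁻ x, ‖f x‖ₑ ^ (2:ℝ)) ^ (1 / (2 * s)) =
      eLpNorm f 2 volume ^ ((α - 2) / (3 * α - 2)) := by
    rw [e2, ← ENNReal.rpow_mul]
    congr 1; rw [his, hr]; field_simp; ring
  have a3 : (s - 1) * (1 / (2 * s)) = 1 / r := by
    rw [hs]; field_simp; ring
  have p1 : 0 ≤ 1 / r := by positivity
  have p2 : 0 ≤ 1 / (2 * s) := by positivity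
  rw [ENNReal.mul_rpow_of_nonneg _ _ p1, ENNReal.mul_rpow_of_nonneg _ _ p1,
    ENNReal.mul_rpow_of_nonneg _ _ p2, ← ENNReal.rpow_mul _ (s - 1), a3, a2,
    ← ENNReal.rpow_mul _ ((r - 1) / 2), a1, ← eα, ← e2, ← e2,
    ENNReal.mul_rpow_of_nonneg _ _ p1, ENNReal.mul_rpow_of_nonneg _ _ p1, hir]
  ring

lemma pd_smooth {f : ℝ × ℝ × ℝ → ℝ} (hf : ContDiff ℝ (⊤ : ℕ∞) f) (i : Fin 3) :
    ContDiff ℝ (⊤ : ℕ∞) (pd i f) := 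
  (hf.fderiv_right (m := (⊤ : ℕ∞)) (by simp)).clm_apply contDiff_const

lemma pd_supp {f : ℝ × ℝ × ℝ → ℝ} (hf : HasCompactSupport f) (i : Fin 3) :
    HasCompactSupport (pd i f) := hf.fderiv_apply ℝ _

lemma le_sqrt2 (a : Fin 3 → Fin 3 → ℝ) (k j : Fin 3) :
    ‖a k j‖ ≤ √(∑ k : Fin 3, ∑ j : Fin 3, a k j ^ 2) := by
  rw [Real.norm_eq_abs]
  refine Real.abs_le_sqrt ?_
  refine le_trans ?_ (Finset.single_le_sum (f := fun k => ∑ j : Fin 3, a k j ^ 2)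
    (fun i _ => Finset.sum_nonneg fun _ _ => sq_nonneg _) (Finset.mem_univ k))
  exact Finset.single_le_sum (f := fun j => a k j ^ 2) (fun i _ => sq_nonneg _) (Finset.mem_univ j)

lemma sqrt_le2 (a : Fin 3 → Fin 3 → ℝ) :
    √(∑ k : Fin 3, ∑ j : Fin 3, a k j ^ 2) ≤ ∑ k : Fin 3, ∑ j : Fin 3, ‖a k j‖ := by
  rw [Real.sqrt_le_iff]
  refine ⟨Finset.sum_nonneg fun _ _ => Finset.sum_nonneg fun _ _ => norm_nonneg _, ?_⟩
  refine le_trans (Finset.sum_le_sum fun k _ => ?_) (Finset.sum_sq_le_sq_sum_of_nonneg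
    (f := fun k => ∑ j : Fin 3, ‖a k j‖) fun _ _ => Finset.sum_nonneg fun _ _ => norm_nonneg _)
  refine le_trans (le_of_eq ?_) (Finset.sum_sq_le_sq_sum_of_nonneg
    (f := fun j => ‖a k j‖) fun _ _ => norm_nonneg _)
  simp

theorem stmt12 (α : ℝ) (hα : 2 < α) :
    ∃ C : ℝ≥0∞, C ≠ ⊤ ∧ ∀ u : Fin 3 → ℝ × ℝ × ℝ → ℝ,
      (∀ k, ContDiff ℝ (⊤ : ℕ∞) (u k)) → (∀ k, HasCompactSupport (u k)) →
      (∀ x, pd 0 (u 0) x + pd 1 (u 1) x + pd 2 (u 2) x = 0) →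
      ENNReal.ofReal (∫ x, |u 2 x| * gradNorm u x * gradHGradNorm u x) ≤
        C * eLpNorm (u 2) 2 volume ^ (2 * (α - 1) / (3 * α - 2))
          * eLpNorm (pd 2 (u 2)) (ENNReal.ofReal α) volume ^ (α / (3 * α - 2))
          * eLpNorm (gradNorm u) 2 volume ^ ((α - 2) / (3 * α - 2))
          * eLpNorm (dGradNorm 0 u) 2 volume ^ (α / (3 * α - 2))
          * eLpNorm (dGradNorm 1 u) 2 volume ^ (α / (3 * α - 2))
          * eLpNorm (gradHGradNorm u) 2 volume := by
  have hα0 : 0 < α := by linarith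
  have hd0 : 0 < 3 * α - 2 := by linarith
  have hr0 : 0 < (3 * α - 2) / α := by positivity
  set r := (3 * α - 2) / α with hr
  set s := r / (r - 2) with hs
  set C : ℝ≥0∞ := ENNReal.ofReal r ^ (1 / r) * (ENNReal.ofReal s ^ (2:ℕ)) ^ (1 / r) with hC
  refine ⟨9 * C, ?_, ?_⟩
  · refine ENNReal.mul_ne_top (by simp) (ENNReal.mul_ne_top ?_ ?_)
    · exact ENNReal.rpow_ne_top_of_nonneg (by positivity) (by simp)
    · exact ENNReal.rpow_ne_top_of_nonneg (by positivity) (by simp)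
  intro u hu huc _
  have hg : Measurable (gradHGradNorm u) := by
    refine Continuous.measurable ?_
    unfold gradHGradNorm
    refine Real.continuous_sqrt.comp ?_
    refine continuous_finsetSum _ fun k _ => continuous_finsetSum _ fun j _ =>
      continuous_finsetSum _ fun l _ => ?_
    exact (pd_smooth (pd_smooth (hu k) j) _).continuous.pow 2
  have h1 : ∀ k j, ContDiff ℝ 1 (pd j (u k)) := fun k j => (pd_smooth (hu k) j).of_le (by simp)
  have hm : ∀ k j, Measurable (pd j (u k)) := fun k j => (h1 k j).continuous.measurable
  have hu2 : Measurable (u 2) := (hu 2).continuous.measurable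
  set RHS := C * eLpNorm (u 2) 2 volume ^ (2 * (α - 1) / (3 * α - 2))
          * eLpNorm (pd 2 (u 2)) (ENNReal.ofReal α) volume ^ (α / (3 * α - 2))
          * eLpNorm (gradNorm u) 2 volume ^ ((α - 2) / (3 * α - 2))
          * eLpNorm (dGradNorm 0 u) 2 volume ^ (α / (3 * α - 2))
          * eLpNorm (dGradNorm 1 u) 2 volume ^ (α / (3 * α - 2))
          * eLpNorm (gradHGradNorm u) 2 volume with hRHS
  have comp : ∀ k j, ∫⁻ x, ‖u 2 x‖ₑ * ‖pd j (u k) x‖ₑ * ‖gradHGradNorm u x‖ₑ ≤ RHS := by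
    intro k j
    refine (tri hα hr hs ((hu 2).of_le (by simp)) (huc 2) (h1 k j) (pd_supp (huc k) j) hg).trans ?_
    have q1 : 0 ≤ (α - 2) / (3 * α - 2) := div_nonneg (by linarith) hd0.le
    have q2 : 0 ≤ α / (3 * α - 2) := div_nonneg (by linarith) hd0.le
    have b0 : eLpNorm (pd j (u k)) 2 volume ≤ eLpNorm (gradNorm u) 2 volume :=
      eLpNorm_mono_real fun x => le_sqrt2 (fun k j => pd j (u k) x) k j
    have b1 : ∀ i, eLpNorm (pd i (pd j (u k))) 2 volume ≤ eLpNorm (dGradNorm i u) 2 volume :=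
      fun i => eLpNorm_mono_real fun x => le_sqrt2 (fun k j => pd i (pd j (u k)) x) k j
    have c0 := ENNReal.rpow_le_rpow b0 q1
    have c1 := ENNReal.rpow_le_rpow (b1 0) q2
    have c2 := ENNReal.rpow_le_rpow (b1 1) q2
    rw [hRHS]
    gcongr
  calc ENNReal.ofReal (∫ x, |u 2 x| * gradNorm u x * gradHGradNorm u x)
      ≤ ‖∫ x, |u 2 x| * gradNorm u x * gradHGradNorm u x‖ₑ := Real.ofReal_le_enorm _
    _ ≤ ∫⁻ x, ‖|u 2 x| * gradNorm u x * gradHGradNorm u x‖ₑ := enorm_integral_le_lintegral_enorm _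
    _ ≤ ∫⁻ x, ∑ k : Fin 3, ∑ j : Fin 3,
          ‖u 2 x‖ₑ * ‖pd j (u k) x‖ₑ * ‖gradHGradNorm u x‖ₑ := by
        refine lintegral_mono fun x => ?_
        simp only [← Finset.sum_mul, ← Finset.mul_sum]
        rw [enorm_mul, enorm_mul]
        gcongr
        · simp
        · have h := ENNReal.ofReal_le_ofReal (sqrt_le2 (fun k j => pd j (u k) x))
          rw [ENNReal.ofReal_sum_of_nonneg
            (fun _ _ => Finset.sum_nonneg fun _ _ => norm_nonneg _)] at h
          simp only [ENNReal.ofReal_sum_of_nonneg (fun _ _ => norm_nonneg _), ofReal_norm] at h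
          rw [gradNorm, Real.enorm_of_nonneg (Real.sqrt_nonneg _)]
          exact h
    _ = ∑ k : Fin 3, ∑ j : Fin 3, ∫⁻ x, ‖u 2 x‖ₑ * ‖pd j (u k) x‖ₑ * ‖gradHGradNorm u x‖ₑ := by
        rw [lintegral_finsetSum _ (fun k _ => by fun_prop)]
        refine Finset.sum_congr rfl fun k _ => ?_
        rw [lintegral_finsetSum _ (fun j _ => by fun_prop)]
    _ ≤ ∑ k : Fin 3, ∑ j : Fin 3, RHS :=
        Finset.sum_le_sum fun k _ => Finset.sum_le_sum fun j _ => comp k j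
    _ = 9 * RHS := by
        simp only [Finset.sum_const, Finset.card_univ, Fintype.card_fin, nsmul_eq_mul, ← mul_assoc]
        norm_num
    _ = _ := by rw [hRHS]; ring
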